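/- Let G be a connected graph on n ≥ 2 vertices with clique number ω ≥ 2. Then μ_α(G) ≤ μ_α(Ki_{n,ω}), with equality if and only if G ≅ Ki_{n,ω}, where Ki_{n,ω} is the kite graph: a complete graph K_ω with a path P_{n−ω} attached by an edge to one of its vertices. -/

import Mathlib

open Finset Matrix

namespace DistAlpha

variable {V : Type*} [Fintype V] [DecidableEq V]

/-- The distance matrix of a graph, with real entries. -/
noncomputable def distMatrix (G : SimpleGraph V) : Matrix V V ℝ :=
  fun u v => (G.dist u v : ℝ)

/-- The transmission of a vertex: the sum of distances to all vertices. -/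
noncomputable def transmission (G : SimpleGraph V) (u : V) : ℝ :=
  ∑ v, (G.dist u v : ℝ)

/-- The matrix `D_α = α T + (1-α) D`. -/
noncomputable def Dalpha (G : SimpleGraph V) (α : ℝ) : Matrix V V ℝ :=
  α • Matrix.diagonal (transmission G) + (1 - α) • distMatrix G

/-- The distance α-spectral radius: the largest (real) eigenvalue of `D_α`. -/
noncomputable def muAlpha (G : SimpleGraph V) (α : ℝ) : ℝ :=
  sSup (spectrum ℝ (Dalpha G α))

/-- The transmission of a graph: sum of distances over unordered pairs. -/
noncomputable def sigma (G : SimpleGraph V) : ℝ :=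
  (∑ u, ∑ v, (G.dist u v : ℝ)) / 2

/-- A graph is transmission regular if all vertex transmissions are equal. -/
def TransmissionRegular (G : SimpleGraph V) : Prop :=
  ∀ u v : V, transmission G u = transmission G v

/-- The kite `Ki_{n,ω}`: a complete graph on the vertices `0, …, ω-1` together with the
path `ω - (ω+1) - ⋯ - (n-1)` attached by the edge from `ω-1` to `ω`. -/
def kite (n ω : ℕ) : SimpleGraph (Fin n) :=
  SimpleGraph.fromRel (fun u v =>
    (u.val < ω ∧ v.val < ω) ∨ (u.val + 1 = v.val ∧ ω ≤ v.val))

/-- The distance between the vertices `i` and `j` of the kite with clique number `k + 2`: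
the vertices `0, …, k` of the clique sit at the same position `k` of the path. -/
def kiteDist (k i j : ℕ) : ℕ :=
  if i = j then 0 else max 1 (max i k - max j k + (max j k - max i k))

/-- The distances in the graph obtained from the kite on `0, …, m - 1` by attaching the pendant
vertex `m` to the vertex `p`. -/
def leafDist (k m p i j : ℕ) : ℕ :=
  if i = m then (if j = m then 0 else kiteDist k p j + 1)
  else if j = m then kiteDist k p i + 1 else kiteDist k i j

/-- The distances in the graph on `0, 1, 2, …` consisting of the path `k, k + 1, …` and a clique
formed by the vertices `0, …, k - 1` and the two path vertices `k + i`, `k + i + 1`. -/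
def slideDist (k i a b : ℕ) : ℕ :=
  if a = b then 0 else
  if a < k then (if b < k then 1 else 1 + (k + i - b) + (b - (k + i + 1)))
  else (if b < k then 1 + (k + i - a) + (a - (k + i + 1)) else (a - b) + (b - a))

/-- Relabelling which puts the pendant vertex `m` and its neighbour `p ≤ k` at the start of the
path of `slideDist`. -/
def shiftLabel (k m p i : ℕ) : ℕ :=
  if i = m then k else if i = p then k + 1 else if i = k then p else if i < k then i else i + 1

/-- Reversal of the path `k, …, m`. -/
def reverseLabel (k m i : ℕ) : ℕ := if i < k then i else m + k - i

lemma kiteDist_comm (k i j : ℕ) : kiteDist k i j = kiteDist k j i := by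
  unfold kiteDist; grind

lemma leafDist_last {k m i j : ℕ} (hm : k + 2 ≤ m) (hi : i ≤ m) (hj : j ≤ m) :
    leafDist k m (m - 1) i j = kiteDist k i j := by
  unfold leafDist kiteDist; split_ifs <;> omega

lemma two_mul_leafDist_le {k m p i j : ℕ} (hk : k < p) :
    2 * leafDist k m p i j ≤ leafDist k m (p - 1) i j + leafDist k m (p + 1) i j := by
  unfold leafDist kiteDist; split_ifs <;> omega

lemma two_mul_leafDist_lt {k m p : ℕ} (hk : k < p) (hp : p < m) :
    2 * leafDist k m p m p < leafDist k m (p - 1) m p + leafDist k m (p + 1) m p := by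
  unfold leafDist kiteDist; split_ifs <;> omega

lemma two_mul_slideDist_le {k i a b : ℕ} (hi : 0 < i) :
    2 * slideDist k i a b ≤ slideDist k (i - 1) a b + slideDist k (i + 1) a b := by
  unfold slideDist; split_ifs <;> omega

lemma two_mul_slideDist_lt {k i : ℕ} (hk : 0 < k) (hi : 0 < i) :
    2 * slideDist k i 0 (k + i) < slideDist k (i - 1) 0 (k + i) + slideDist k (i + 1) 0 (k + i) := by
  unfold slideDist; split_ifs <;> omega

lemma slideDist_zero {k a b : ℕ} : slideDist k 0 a b = kiteDist k a b := by
  unfold slideDist kiteDist; split_ifs <;> omega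

lemma slideDist_last {k m a b : ℕ} (hm : k + 2 ≤ m) (ha : a ≤ m) (hb : b ≤ m) :
    slideDist k (m - k - 1) a b = kiteDist k (reverseLabel k m a) (reverseLabel k m b) := by
  unfold slideDist kiteDist reverseLabel; split_ifs <;> omega

lemma leafDist_eq_slideDist {k m p i j : ℕ} (hm : k + 2 ≤ m) (hp : p ≤ k) (hi : i ≤ m)
    (hj : j ≤ m) :
    leafDist k m p i j = slideDist k 1 (shiftLabel k m p i) (shiftLabel k m p j) := by
  have key : ∀ l ≤ m, (l = m ∧ shiftLabel k m p l = k) ∨ (l = p ∧ shiftLabel k m p l = k + 1) ∨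
      (l ≠ m ∧ l ≠ p ∧ l = k ∧ shiftLabel k m p l = p) ∨
      (l ≠ m ∧ l ≠ p ∧ l < k ∧ shiftLabel k m p l = l) ∨
      (l ≠ m ∧ l ≠ p ∧ k < l ∧ shiftLabel k m p l = l + 1) := by
    intro l hl
    unfold shiftLabel; split_ifs <;> omega
  have hi' := key i hi
  have hj' := key j hj
  generalize shiftLabel k m p i = a at *
  generalize shiftLabel k m p j = b at *
  clear key
  rcases hi' with ⟨rfl, rfl⟩ | ⟨rfl, rfl⟩ | ⟨h1, h2, rfl, rfl⟩ | ⟨h1, h2, h3, rfl⟩ |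
      ⟨h1, h2, h3, rfl⟩ <;>
    rcases hj' with ⟨h4, rfl⟩ | ⟨h4, rfl⟩ | ⟨h4, h5, h6, rfl⟩ | ⟨h4, h5, h6, rfl⟩ |
      ⟨h4, h5, h6, rfl⟩ <;>
    unfold leafDist slideDist kiteDist <;> grind

lemma shiftLabel_le {k m p i : ℕ} (hm : k + 1 ≤ m) (hp : p ≤ k) (hi : i ≤ m) :
    shiftLabel k m p i ≤ m := by
  unfold shiftLabel; split_ifs <;> omega

lemma shiftLabel_inj {k m p i j : ℕ} (hp : p ≤ k)
    (h : shiftLabel k m p i = shiftLabel k m p j) : i = j := by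
  unfold shiftLabel at h; split_ifs at h <;> omega

lemma reverseLabel_le {k m i : ℕ} (hi : i ≤ m) : reverseLabel k m i ≤ m := by
  unfold reverseLabel; split_ifs <;> omega

lemma reverseLabel_inj {k m i j : ℕ} (hi : i ≤ m) (hj : j ≤ m)
    (h : reverseLabel k m i = reverseLabel k m j) : i = j := by
  unfold reverseLabel at h; split_ifs at h <;> omega

/-- A strictly convex sequence does not attain its maximum in the interior. -/
lemma lt_or_lt_of_strictConvex {f : ℕ → ℝ} {a b p : ℕ}
    (hf : ∀ q, a < q → q < b → 2 * f q < f (q - 1) + f (q + 1)) (ha : a < p) (hb : p < b) :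
    f p < f a ∨ f p < f b := by
  by_contra! h
  obtain ⟨q, hq, hmax⟩ := (Ioo a b).exists_max_image f ⟨p, by simp [ha, hb]⟩
  have hp := hmax p (by simp [ha, hb])
  rw [mem_Ioo] at hq
  have key : ∀ r, a ≤ r → r ≤ b → f r ≤ f q := fun r hr hr' => by
    rcases hr.eq_or_lt with rfl | hr
    · linarith
    rcases hr'.eq_or_lt with rfl | hr'
    · linarith
    exact hmax r (by simp [hr, hr'])
  linarith [hf q hq.1 hq.2, key (q - 1) (by omega) (by omega), key (q + 1) (by omega) (by omega)]

section Labelling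

variable {W : Type*} [DecidableEq W]

/-- The sum of the entries of `F` over pairs of elements of `S`, weighted by `w`. -/
def weightedSum (w : W → W → ℝ) (F : W → W → ℕ) (S : Finset W) : ℝ :=
  ∑ a ∈ S, ∑ b ∈ S, w a b * F a b

/-- The function `L` numbers the elements of `S` by `0, …, #S - 1`. -/
def IsLabelling (L : W → ℕ) (S : Finset W) : Prop :=
  Set.InjOn L S ∧ ∀ a ∈ S, L a < #S

/-- Some placement of `S` on the vertices of a kite has larger weighted sum of distances than `F`,
or its distances agree with `F`. -/
def KiteBound (k : ℕ) (w : W → W → ℝ) (S : Finset W) (F : W → W → ℕ) : Prop :=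
  ∃ L, IsLabelling L S ∧ (weightedSum w F S < weightedSum w (fun a b => kiteDist k (L a) (L b)) S ∨
    ∀ a ∈ S, ∀ b ∈ S, F a b = kiteDist k (L a) (L b))

omit [DecidableEq W] in
lemma IsLabelling.exists_eq {L : W → ℕ} {S : Finset W} (hL : IsLabelling L S) {i : ℕ}
    (hi : i < #S) : ∃ a ∈ S, L a = i := by
  have h := Finset.surj_on_of_inj_on_of_card_le (s := S) (t := range #S) (fun a _ => L a)
    (fun a ha => mem_range.2 (hL.2 a ha)) (fun a b ha hb h => hL.1 ha hb h) (by simp) i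
    (mem_range.2 hi)
  obtain ⟨a, ha, h⟩ := h
  exact ⟨a, ha, h.symm⟩

omit [DecidableEq W] in
lemma IsLabelling.comp {L : W → ℕ} {S : Finset W} (hL : IsLabelling L S) {f : ℕ → ℕ}
    (hf : ∀ i < #S, f i < #S) (hinj : ∀ i < #S, ∀ j < #S, f i = f j → i = j) :
    IsLabelling (fun a => f (L a)) S :=
  ⟨fun a ha b hb h => hL.1 ha hb (hinj _ (hL.2 a ha) _ (hL.2 b hb) h),
    fun a ha => hf _ (hL.2 a ha)⟩

omit [DecidableEq W] in
lemma weightedSum_congr {w : W → W → ℝ} {S : Finset W} {F F' : W → W → ℕ}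
    (h : ∀ a ∈ S, ∀ b ∈ S, F a b = F' a b) : weightedSum w F S = weightedSum w F' S :=
  sum_congr rfl fun a ha => sum_congr rfl fun b hb => by rw [h a ha b hb]

omit [DecidableEq W] in
lemma weightedSum_le {w : W → W → ℝ} (hw : ∀ a b, 0 < w a b) {S : Finset W} {F F' : W → W → ℕ}
    (h : ∀ a ∈ S, ∀ b ∈ S, F a b ≤ F' a b) : weightedSum w F S ≤ weightedSum w F' S := by
  refine sum_le_sum fun a ha => sum_le_sum fun b hb => ?_
  have := h a ha b hb
  have := (hw a b).le
  gcongr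

omit [DecidableEq W] in
lemma weightedSum_lt {w : W → W → ℝ} (hw : ∀ a b, 0 < w a b) {S : Finset W} {F F' : W → W → ℕ}
    (h : ∀ a ∈ S, ∀ b ∈ S, F a b ≤ F' a b) {x y : W} (hx : x ∈ S) (hy : y ∈ S)
    (hxy : F x y < F' x y) : weightedSum w F S < weightedSum w F' S := by
  have hle : ∀ a ∈ S, ∀ b ∈ S, w a b * F a b ≤ w a b * F' a b := fun a ha b hb => by
    have := h a ha b hb
    have := (hw a b).le
    gcongr
  refine sum_lt_sum (fun a ha => sum_le_sum (hle a ha)) ⟨x, hx, sum_lt_sum (hle x hx) ⟨y, hy, ?_⟩⟩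
  have := hw x y
  gcongr

omit [DecidableEq W] in
lemma two_mul_weightedSum_lt {w : W → W → ℝ} (hw : ∀ a b, 0 < w a b) {S : Finset W}
    {F F₁ F₂ : W → W → ℕ} (h : ∀ a ∈ S, ∀ b ∈ S, 2 * F a b ≤ F₁ a b + F₂ a b) {x y : W}
    (hx : x ∈ S) (hy : y ∈ S) (hxy : 2 * F x y < F₁ x y + F₂ x y) :
    2 * weightedSum w F S < weightedSum w F₁ S + weightedSum w F₂ S := by
  have h1 : 2 * weightedSum w F S = weightedSum w (fun a b => 2 * F a b) S := by
    simp only [weightedSum, mul_sum]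
    exact sum_congr rfl fun a _ => sum_congr rfl fun b _ => by push_cast; ring
  have h2 : weightedSum w F₁ S + weightedSum w F₂ S =
      weightedSum w (fun a b => F₁ a b + F₂ a b) S := by
    simp only [weightedSum, ← sum_add_distrib]
    exact sum_congr rfl fun a _ => sum_congr rfl fun b _ => by push_cast; ring
  rw [h1, h2]
  exact weightedSum_lt hw h hx hy hxy

omit [DecidableEq W] in
lemma KiteBound.of_lt {k : ℕ} {w : W → W → ℝ} {S : Finset W} {F F' : W → W → ℕ}
    (h' : KiteBound k w S F') (h : weightedSum w F S < weightedSum w F' S) :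
    KiteBound k w S F := by
  obtain ⟨L, hL, hlt | heq⟩ := h'
  · exact ⟨L, hL, .inl (h.trans hlt)⟩
  · exact ⟨L, hL, .inl (h.trans_eq (weightedSum_congr heq))⟩

omit [DecidableEq W] in
lemma KiteBound.of_le {k : ℕ} {w : W → W → ℝ} (hw : ∀ a b, 0 < w a b) {S : Finset W}
    {F F' : W → W → ℕ} (h' : KiteBound k w S F') (h : ∀ a ∈ S, ∀ b ∈ S, F a b ≤ F' a b) :
    KiteBound k w S F := by
  by_cases heq : ∀ a ∈ S, ∀ b ∈ S, F' a b ≤ F a b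
  · obtain ⟨L, hL, hlt | heq'⟩ := h'
    · exact ⟨L, hL, .inl ((weightedSum_le hw h).trans_lt hlt)⟩
    · exact ⟨L, hL, .inr fun a ha b hb =>
        ((h a ha b hb).antisymm (heq a ha b hb)).trans (heq' a ha b hb)⟩
  · push Not at heq
    obtain ⟨x, hx, y, hy, hxy⟩ := heq
    exact h'.of_lt (weightedSum_lt hw h hx hy hxy)

omit [DecidableEq W] in
lemma kiteBound_slideDist {k m : ℕ} {w : W → W → ℝ} (hw : ∀ a b, 0 < w a b) {S : Finset W}
    {L : W → ℕ} (hL : IsLabelling L S) (hS : #S = m + 1) (hm : k + 2 ≤ m) :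
    KiteBound k w S (fun a b => slideDist k 1 (L a) (L b)) := by
  have hle : ∀ a ∈ S, L a ≤ m := fun a ha => by have := hL.2 a ha; omega
  have hfirst : KiteBound k w S (fun a b => slideDist k 0 (L a) (L b)) :=
    ⟨L, hL, .inr fun a _ b _ => slideDist_zero⟩
  have hlast : KiteBound k w S (fun a b => slideDist k (m - k - 1) (L a) (L b)) := by
    refine ⟨fun a => reverseLabel k m (L a), hL.comp (fun i hi => ?_) (fun i hi j hj => ?_),
      .inr fun a ha b hb => slideDist_last hm (hle a ha) (hle b hb)⟩
    · have := reverseLabel_le (k := k) (m := m) (i := i) (by omega)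
      omega
    · exact reverseLabel_inj (by omega) (by omega)
  rcases Nat.eq_zero_or_pos k with rfl | hk
  · convert hfirst using 3
    simp [slideDist]
  rcases hm.eq_or_lt with hm' | hm'
  · convert hlast using 4
    omega
  have hconv : ∀ q, 0 < q → q < m - k - 1 →
      2 * weightedSum w (fun a b => slideDist k q (L a) (L b)) S <
        weightedSum w (fun a b => slideDist k (q - 1) (L a) (L b)) S +
          weightedSum w (fun a b => slideDist k (q + 1) (L a) (L b)) S := by
    intro q hq hq'
    obtain ⟨x, hx, hx0⟩ := hL.exists_eq (i := 0) (by omega)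
    obtain ⟨y, hy, hyq⟩ := hL.exists_eq (i := k + q) (by omega)
    refine two_mul_weightedSum_lt hw (fun a _ b _ => two_mul_slideDist_le hq) hx hy ?_
    simp only [hx0, hyq]
    exact two_mul_slideDist_lt hk hq
  rcases lt_or_lt_of_strictConvex
    (f := fun q => weightedSum w (fun a b => slideDist k q (L a) (L b)) S) (p := 1)
    hconv (by omega) (by omega) with h | h
  · exact hfirst.of_lt h
  · exact hlast.of_lt h

omit [DecidableEq W] in
lemma kiteBound_leafDist {k m p : ℕ} {w : W → W → ℝ} (hw : ∀ a b, 0 < w a b) {S : Finset W}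
    {L : W → ℕ} (hL : IsLabelling L S) (hS : #S = m + 1) (hm : k + 2 ≤ m) (hp : p < m) :
    KiteBound k w S (fun a b => leafDist k m p (L a) (L b)) := by
  have hle : ∀ a ∈ S, L a ≤ m := fun a ha => by have := hL.2 a ha; omega
  have hclique : ∀ p ≤ k, KiteBound k w S (fun a b => leafDist k m p (L a) (L b)) := by
    intro p hp
    have hL' : IsLabelling (fun a => shiftLabel k m p (L a)) S := by
      refine hL.comp (fun i hi => ?_) (fun i hi j hj => shiftLabel_inj hp)
      have := shiftLabel_le (k := k) (m := m) (p := p) (i := i) (by omega) hp (by omega)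
      omega
    exact (kiteBound_slideDist hw hL' hS hm).of_le hw fun a ha b hb =>
      (leafDist_eq_slideDist hm hp (hle a ha) (hle b hb)).le
  have hlast : KiteBound k w S (fun a b => leafDist k m (m - 1) (L a) (L b)) :=
    ⟨L, hL, .inr fun a ha b hb => leafDist_last hm (hle a ha) (hle b hb)⟩
  rcases le_or_gt p k with hpk | hpk
  · exact hclique p hpk
  rcases (Nat.le_sub_one_of_lt hp).eq_or_lt with rfl | hpm
  · exact hlast
  have hconv : ∀ q, k < q → q < m - 1 →
      2 * weightedSum w (fun a b => leafDist k m q (L a) (L b)) S <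
        weightedSum w (fun a b => leafDist k m (q - 1) (L a) (L b)) S +
          weightedSum w (fun a b => leafDist k m (q + 1) (L a) (L b)) S := by
    intro q hq hq'
    obtain ⟨x, hx, hxm⟩ := hL.exists_eq (i := m) (by omega)
    obtain ⟨y, hy, hyq⟩ := hL.exists_eq (i := q) (by omega)
    refine two_mul_weightedSum_lt hw (fun a _ b _ => two_mul_leafDist_le hq) hx hy ?_
    simp only [hxm, hyq]
    exact two_mul_leafDist_lt hq (by omega)
  rcases lt_or_lt_of_strictConvex
    (f := fun q => weightedSum w (fun a b => leafDist k m q (L a) (L b)) S)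
    hconv hpk hpm with h | h
  · exact (hclique k le_rfl).of_lt h
  · exact hlast.of_lt h

lemma weightedSum_insert {w : W → W → ℝ} {F : W → W → ℕ} {S : Finset W} {x : W} (hx : x ∉ S) :
    weightedSum w F (insert x S) = weightedSum w F S + w x x * F x x +
      ∑ a ∈ S, (w x a * F x a + w a x * F a x) := by
  simp only [weightedSum, sum_insert hx, sum_add_distrib]
  ring

/-- The weights obtained from `w` by moving the weight of `x` to `p`. -/
def mergeWeight (w : W → W → ℝ) (x p a b : W) : ℝ :=
  w a b + (if a = p then w x b else 0) + if b = p then w a x else 0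

lemma weightedSum_mergeWeight (w : W → W → ℝ) (F : W → W → ℕ) {S : Finset W} {x p : W}
    (hp : p ∈ S) : weightedSum (mergeWeight w x p) F S =
      weightedSum w F S + ∑ a ∈ S, (w x a * F p a + w a x * F a p) := by
  simp [weightedSum, mergeWeight, add_mul, sum_add_distrib, ite_mul, hp, add_assoc]

/-- Attaching one more vertex `x` to the vertex `p` preserves the bound by a kite. -/
lemma kiteBound_insert {k : ℕ} {S : Finset W} {x p : W} (hx : x ∉ S) (hp : p ∈ S)
    (hS : k + 2 ≤ #S) {d : W → W → ℕ} (hself : d x x = 0) (hcomm : ∀ a, d a x = d x a)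
    (hd : ∀ a ∈ S, d x a ≤ d p a + 1)
    (hcomm' : ∀ a, d a p = d p a)
    (h : ∀ w : W → W → ℝ, (∀ a b, 0 < w a b) → KiteBound k w S d) {w : W → W → ℝ}
    (hw : ∀ a b, 0 < w a b) : KiteBound k w (insert x S) d := by
  have hw' : ∀ a b, 0 < mergeWeight w x p a b := fun a b => by
    have h1 := hw a b
    have h2 := hw x b
    have h3 := hw a x
    unfold mergeWeight
    split_ifs <;> linarith
  obtain ⟨L, hL, hcase⟩ := h _ hw'
  set m := #S with hm
  set L' : W → ℕ := Function.update L x m with hL'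
  have hLx : L' x = m := by simp [hL']
  have hLS : ∀ a ∈ S, L' a = L a := fun a ha => by
    simp [hL', ne_of_mem_of_not_mem ha hx]
  have hLm : ∀ a ∈ S, L a ≠ m := fun a ha => (hL.2 a ha).ne
  have hlab : IsLabelling L' (insert x S) := by
    constructor
    · intro a ha b hb hab
      simp only [coe_insert, Set.mem_insert_iff, mem_coe] at ha hb
      rcases ha with rfl | ha <;> rcases hb with rfl | hb
      · rfl
      · rw [hLx, hLS b hb] at hab
        have := hL.2 b hb
        omega
      · rw [hLx, hLS a ha] at hab
        have := hL.2 a ha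
        omega
      · rw [hLS a ha, hLS b hb] at hab
        exact hL.1 ha hb hab
    · intro a ha
      rw [card_insert_of_notMem hx]
      rcases mem_insert.1 ha with rfl | ha
      · omega
      · rw [hLS a ha]
        have := hL.2 a ha
        omega
  have hleaf := kiteBound_leafDist (p := L p) hw hlab (card_insert_of_notMem hx) hS (hL.2 p hp)
  have hEx : leafDist k m (L p) (L' x) (L' x) = 0 := by simp [leafDist, hLx]
  have hE : ∀ a ∈ S, leafDist k m (L p) (L' x) (L' a) = kiteDist k (L p) (L a) + 1 := by
    intro a ha
    simp [leafDist, hLx, hLS a ha, hLm a ha]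
  have hE' : ∀ a ∈ S, leafDist k m (L p) (L' a) (L' x) = kiteDist k (L p) (L a) + 1 := by
    intro a ha
    simp [leafDist, hLx, hLS a ha, hLm a ha]
  have hES : ∀ a ∈ S, ∀ b ∈ S,
      leafDist k m (L p) (L' a) (L' b) = kiteDist k (L a) (L b) := by
    intro a ha b hb
    simp [leafDist, hLS a ha, hLS b hb, hLm a ha, hLm b hb]
  rcases hcase with hlt | heq
  · refine hleaf.of_lt ?_
    rw [weightedSum_mergeWeight w _ hp, weightedSum_mergeWeight w _ hp] at hlt
    rw [weightedSum_insert hx, weightedSum_insert hx, weightedSum_congr hES]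
    have h1 : ∑ a ∈ S, (w x a * d x a + w a x * d a x) ≤
        ∑ a ∈ S, (w x a * d p a + w a x * d a p) + ∑ a ∈ S, (w x a + w a x) := by
      rw [← sum_add_distrib]
      refine sum_le_sum fun a ha => ?_
      rw [hcomm a, hcomm' a]
      have h2 : (d x a : ℝ) ≤ d p a + 1 := by exact_mod_cast hd a ha
      nlinarith [hw x a, hw a x]
    have h2 : ∑ a ∈ S, (w x a * (leafDist k m (L p) (L' x) (L' a) : ℕ) +
          w a x * (leafDist k m (L p) (L' a) (L' x) : ℕ)) =
        ∑ a ∈ S, (w x a * (kiteDist k (L p) (L a) : ℕ) + w a x * (kiteDist k (L a) (L p) : ℕ)) +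
          ∑ a ∈ S, (w x a + w a x) := by
      rw [← sum_add_distrib]
      refine sum_congr rfl fun a ha => ?_
      rw [hE a ha, hE' a ha, kiteDist_comm k (L a)]
      push_cast
      ring
    rw [h2, hself, hEx]
    linarith
  · refine hleaf.of_le hw fun a ha b hb => ?_
    rcases mem_insert.1 ha with rfl | ha' <;> rcases mem_insert.1 hb with rfl | hb'
    · simp [hself]
    · rw [hE b hb', ← heq p hp b hb']
      exact hd b hb'
    · rw [hE' a ha', ← heq p hp a ha', hcomm]
      exact hd a ha'
    · rw [hES a ha' b hb', heq a ha' b hb']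

lemma exists_kiteBound {k : ℕ} {G : SimpleGraph W} (hG : G.Connected) [Fintype W] {K : Finset W}
    (hK : G.IsNClique (k + 2) K) {m : ℕ} (hkm : k + 2 ≤ m) (hm : m ≤ Fintype.card W) :
    ∃ S : Finset W, K ⊆ S ∧ #S = m ∧
      ∀ w : W → W → ℝ, (∀ a b, 0 < w a b) → KiteBound k w S G.dist := by
  induction m, hkm using Nat.le_induction with
  | base =>
    refine ⟨K, subset_rfl, hK.card_eq, fun w _ => ?_⟩
    let e := K.equivFinOfCardEq hK.card_eq
    let L : W → ℕ := fun a => if ha : a ∈ K then e ⟨a, ha⟩ else 0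
    have hL : ∀ a (ha : a ∈ K), L a = e ⟨a, ha⟩ := fun a ha => by simp [L, ha]
    have hinj : Set.InjOn L K := fun a ha b hb hab => by
      rw [hL a ha, hL b hb] at hab
      simpa using e.injective (Fin.ext hab)
    refine ⟨L, ⟨hinj, fun a ha => ?_⟩, .inr fun a ha b hb => ?_⟩
    · rw [hL a ha, hK.card_eq]
      exact (e _).2
    · by_cases hab : a = b
      · simp [hab, kiteDist]
      · rw [SimpleGraph.dist_eq_one_iff_adj.2 (hK.isClique ha hb hab)]
        have hne : L a ≠ L b := fun h => hab (hinj ha hb h)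
        have h1 : L a < k + 2 := by rw [hL a ha]; exact (e _).2
        have h2 : L b < k + 2 := by rw [hL b hb]; exact (e _).2
        unfold kiteDist
        rw [if_neg hne]
        omega
  | succ m hkm ih =>
    obtain ⟨S, hKS, hS, h⟩ := ih (by omega)
    obtain ⟨y, hy⟩ : ∃ y, y ∉ S := by
      by_contra! hall
      have := Finset.eq_univ_iff_forall.2 hall
      rw [this, card_univ] at hS
      omega
    obtain ⟨z, hz⟩ : S.Nonempty := card_pos.1 (by omega)
    obtain ⟨q⟩ := hG.preconnected z y
    obtain ⟨t, -, ht, ht'⟩ := q.exists_boundary_dart (S : Set W) hz hy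
    simp only [mem_coe] at ht ht'
    refine ⟨insert t.snd S, hKS.trans (subset_insert _ _), by rw [card_insert_of_notMem ht', hS],
      fun w hw => kiteBound_insert ht' ht (by omega) (by simp) (fun a => G.dist_comm)
        (fun a _ => ?_) (fun a => G.dist_comm) h hw⟩
    have h1 := hG.dist_triangle (u := t.snd) (v := t.fst) (w := a)
    rw [SimpleGraph.dist_eq_one_iff_adj.2 t.adj.symm] at h1
    omega

end Labelling

lemma kiteDist_eq_one_iff {k n : ℕ} (i j : Fin n) :
    kiteDist k i j = 1 ↔ (kite n (k + 2)).Adj i j := by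
  simp only [kite, SimpleGraph.fromRel_adj, kiteDist, ne_eq, Fin.ext_iff]
  by_cases h : (i : ℕ) = j
  · simp [h]
  · rw [if_neg h]
    constructor <;> intro h' <;> omega

lemma kite_connected {k n : ℕ} (hn : 2 ≤ n) : (kite n (k + 2)).Connected := by
  have h0 : 0 < n := by omega
  have key : ∀ i (hi : i < n), (kite n (k + 2)).Reachable ⟨0, h0⟩ ⟨i, hi⟩ := by
    intro i
    induction i with
    | zero => exact fun _ => .rfl
    | succ i ih =>
      intro hi
      refine (ih (by omega)).trans (SimpleGraph.Adj.reachable ?_)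
      simp only [kite, SimpleGraph.fromRel_adj, ne_eq, Fin.ext_iff, true_and]
      omega
  exact (SimpleGraph.connected_iff_exists_forall_reachable _).2 ⟨⟨0, h0⟩, fun i => key i i.2⟩

lemma kiteDist_le_dist {k n : ℕ} (hn : 2 ≤ n) (i j : Fin n) :
    kiteDist k i j ≤ (kite n (k + 2)).dist i j := by
  obtain ⟨p, hp⟩ := (kite_connected (k := k) hn).exists_walk_length_eq_dist i j
  rw [← hp]
  clear hp
  induction p with
  | nil => simp [kiteDist]
  | @cons u v w huv p ih =>
    have h := (kiteDist_eq_one_iff u v).2 huv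
    rw [SimpleGraph.Walk.length_cons]
    revert ih h
    unfold kiteDist
    split_ifs <;> omega

section Spectral

variable {W : Type*} [Fintype W] [DecidableEq W]

lemma posSemidef_sSup_spectrum_sub {M : Matrix W W ℝ} (hM : M.IsHermitian) :
    (sSup (spectrum ℝ M) • (1 : Matrix W W ℝ) - M).PosSemidef := by
  have hfin : (spectrum ℝ M).Finite := hM.spectrum_real_eq_range_eigenvalues ▸ Set.finite_range _
  have hN : (sSup (spectrum ℝ M) • (1 : Matrix W W ℝ) - M).IsHermitian := by
    refine IsHermitian.sub ?_ hM
    simp [IsHermitian]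
  refine hN.posSemidef_iff_eigenvalues_nonneg.2 fun i => ?_
  have h : hN.eigenvalues i ∈ spectrum ℝ (sSup (spectrum ℝ M) • (1 : Matrix W W ℝ) - M) :=
    hN.spectrum_real_eq_range_eigenvalues ▸ Set.mem_range_self i
  generalize hN.eigenvalues i = e at h ⊢
  rw [← Algebra.algebraMap_eq_smul_one, ← spectrum.singleton_sub_eq] at h
  simp only [Set.singleton_sub, Set.mem_image] at h
  obtain ⟨l, hl, h⟩ := h
  have := le_csSup hfin.bddAbove hl
  simp only [Pi.zero_apply]
  linarith

lemma exists_mulVec_eq_sSup_spectrum_smul [Nonempty W] {M : Matrix W W ℝ} (hM : M.IsHermitian) :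
    ∃ x : W → ℝ, x ≠ 0 ∧ M *ᵥ x = sSup (spectrum ℝ M) • x := by
  have hspec := hM.spectrum_real_eq_range_eigenvalues
  have hfin : (spectrum ℝ M).Finite := hspec ▸ Set.finite_range _
  have hne : (spectrum ℝ M).Nonempty := hspec ▸ Set.range_nonempty _
  obtain ⟨i, hi⟩ : sSup (spectrum ℝ M) ∈ Set.range hM.eigenvalues :=
    hspec ▸ hne.csSup_mem hfin
  refine ⟨hM.eigenvectorBasis i, fun h0 => ?_, ?_⟩
  · exact hM.eigenvectorBasis.orthonormal.ne_zero i (by ext j; exact congrFun h0 j)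
  · rw [hM.mulVec_eigenvectorBasis, hi]

lemma Dalpha_isHermitian (G : SimpleGraph W) (α : ℝ) : (Dalpha G α).IsHermitian := by
  ext i j
  by_cases h : i = j
  · simp [h, Dalpha, distMatrix]
  · simp [h, Ne.symm h, Dalpha, distMatrix, G.dist_comm]

lemma Dalpha_mulVec (G : SimpleGraph W) (α : ℝ) (x : W → ℝ) (u : W) :
    (Dalpha G α *ᵥ x) u = ∑ v, G.dist u v * (α * x u + (1 - α) * x v) := by
  rw [Dalpha, add_mulVec, smul_mulVec, smul_mulVec, Pi.add_apply, Pi.smul_apply, Pi.smul_apply,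
    mulVec_diagonal]
  simp only [smul_eq_mul, transmission, mulVec, dotProduct, distMatrix, mul_add, sum_add_distrib,
    mul_sum, sum_mul]
  congr 1 <;> exact sum_congr rfl fun v _ => by ring

/-- The weights for which the quadratic form of `D_α` at `x` is a weighted sum of distances. -/
def formWeight (α : ℝ) (x : W → ℝ) (u v : W) : ℝ := x u * (α * x u + (1 - α) * x v)

lemma dotProduct_Dalpha_mulVec (G : SimpleGraph W) (α : ℝ) (x : W → ℝ) :
    x ⬝ᵥ Dalpha G α *ᵥ x = weightedSum (formWeight α x) G.dist univ := by
  simp only [dotProduct, Dalpha_mulVec, weightedSum, formWeight, mul_sum]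
  exact sum_congr rfl fun u _ => sum_congr rfl fun v _ => by ring

omit [Fintype W] [DecidableEq W] in
lemma formWeight_pos {α : ℝ} (hα0 : 0 ≤ α) (hα1 : α < 1) {x : W → ℝ} (hx : ∀ u, 0 < x u)
    (u v : W) : 0 < formWeight α x u v := by
  have h1 := mul_pos (sub_pos.2 hα1) (hx v)
  have h2 := mul_nonneg hα0 (hx u).le
  exact mul_pos (hx u) (by linarith)

lemma dotProduct_Dalpha_mulVec_le [Nonempty W] (G : SimpleGraph W) (α : ℝ) (x : W → ℝ) :
    x ⬝ᵥ Dalpha G α *ᵥ x ≤ muAlpha G α * (x ⬝ᵥ x) := by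
  have h := (posSemidef_sSup_spectrum_sub (Dalpha_isHermitian G α)).dotProduct_mulVec_nonneg x
  simp only [star_trivial, sub_mulVec, smul_mulVec, one_mulVec, dotProduct_sub, dotProduct_smul,
    smul_eq_mul] at h
  unfold muAlpha
  linarith

lemma exists_pos_eigenvector [Nonempty W] {G : SimpleGraph W} (hG : G.Connected) {α : ℝ}
    (hα0 : 0 ≤ α) (hα1 : α < 1) :
    ∃ x : W → ℝ, (∀ u, 0 < x u) ∧ Dalpha G α *ᵥ x = muAlpha G α • x := by
  obtain ⟨z, hz, hzμ⟩ := exists_mulVec_eq_sSup_spectrum_smul (Dalpha_isHermitian G α)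
  change _ = muAlpha G α • z at hzμ
  set x : W → ℝ := fun u => |z u| with hx
  have hxx : x ⬝ᵥ x = z ⬝ᵥ z := by simp [dotProduct, hx]
  have hle : z ⬝ᵥ Dalpha G α *ᵥ z ≤ x ⬝ᵥ Dalpha G α *ᵥ x := by
    rw [dotProduct_Dalpha_mulVec, dotProduct_Dalpha_mulVec]
    refine sum_le_sum fun u _ => sum_le_sum fun v _ => ?_
    refine mul_le_mul_of_nonneg_right ?_ (Nat.cast_nonneg _)
    have h1 : z u * z v ≤ |z u| * |z v| := (le_abs_self _).trans (abs_mul _ _).le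
    have h2 : |z u| * |z u| = z u * z u := abs_mul_abs_self _
    simp only [formWeight, hx]
    nlinarith
  have hpsd := posSemidef_sSup_spectrum_sub (Dalpha_isHermitian G α)
  have hzero : star x ⬝ᵥ (sSup (spectrum ℝ (Dalpha G α)) • (1 : Matrix W W ℝ) - Dalpha G α) *ᵥ x
      = 0 := by
    refine le_antisymm ?_ (hpsd.dotProduct_mulVec_nonneg x)
    rw [hzμ, dotProduct_smul, smul_eq_mul, ← hxx] at hle
    simp only [star_trivial, sub_mulVec, smul_mulVec, one_mulVec, dotProduct_sub, dotProduct_smul,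
      smul_eq_mul]
    exact sub_nonpos.2 hle
  have hxμ : Dalpha G α *ᵥ x = muAlpha G α • x := by
    have h := (hpsd.dotProduct_mulVec_zero_iff x).1 hzero
    rw [sub_mulVec, smul_mulVec, one_mulVec, sub_eq_zero] at h
    exact h.symm
  refine ⟨x, fun u => (abs_nonneg _).lt_of_ne fun h0 => hz ?_, hxμ⟩
  replace h0 : x u = 0 := h0.symm
  have hsum := congrFun hxμ u
  rw [Dalpha_mulVec, Pi.smul_apply, h0, smul_zero, sum_eq_zero_iff_of_nonneg] at hsum
  · funext v
    by_cases huv : u = v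
    · rw [← huv]
      exact abs_eq_zero.1 h0
    · have h := hsum v (mem_univ v)
      have hd : (G.dist u v : ℝ) ≠ 0 := by exact_mod_cast (hG.pos_dist_of_ne huv).ne'
      have hα : 1 - α ≠ 0 := by linarith
      simpa [hd, hα, hx] using h
  · intro v _
    have := mul_nonneg (sub_pos.2 hα1).le (abs_nonneg (z v))
    rw [mul_zero, zero_add]
    positivity

omit [Fintype W] [DecidableEq W] in
lemma dist_map_le {W' : Type*} {G : SimpleGraph W} {H : SimpleGraph W'} (hG : G.Connected)
    (f : G →g H) (u v : W) : H.dist (f u) (f v) ≤ G.dist u v := by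
  obtain ⟨p, hp⟩ := hG.exists_walk_length_eq_dist u v
  rw [← hp, ← p.length_map f]
  exact SimpleGraph.dist_le _

omit [Fintype W] [DecidableEq W] in
lemma dist_iso {W' : Type*} {G : SimpleGraph W} {H : SimpleGraph W'} (hG : G.Connected)
    (e : G ≃g H) (u v : W) : H.dist (e u) (e v) = G.dist u v := by
  refine (dist_map_le hG e.toHom u v).antisymm ?_
  simpa using dist_map_le (e.connected_iff.1 hG) e.symm.toHom (e u) (e v)

lemma muAlpha_congr {W' : Type*} [Fintype W'] [DecidableEq W'] {G : SimpleGraph W}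
    {H : SimpleGraph W'} (hG : G.Connected) (e : G ≃g H) (α : ℝ) : muAlpha G α = muAlpha H α := by
  have h : Dalpha H α = reindexAlgEquiv ℝ ℝ e.toEquiv (Dalpha G α) := by
    ext i j
    obtain ⟨i, rfl⟩ := e.surjective i
    obtain ⟨j, rfl⟩ := e.surjective j
    have hs : ∀ v, e.toEquiv.symm (e v) = v := e.toEquiv.symm_apply_apply
    rw [coe_reindexAlgEquiv, reindex_apply, submatrix_apply, hs, hs]
    have ht : transmission H (e i) = transmission G i := by
      simp only [transmission, ← dist_iso hG e]
      exact (Equiv.sum_comp e.toEquiv fun v => (H.dist (e i) v : ℝ)).symm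
    by_cases hij : i = j
    · subst hij
      simp [Dalpha, distMatrix, ht]
    · simp [Dalpha, distMatrix, hij, dist_iso hG]
  rw [muAlpha, muAlpha, h, AlgEquiv.spectrum_eq]

end Spectral

/-- among connected graphs on `n ≥ 2` vertices with clique number `ω ≥ 2`,
the kite `Ki_{n,ω}` uniquely maximizes the distance α-spectral radius. -/
theorem muAlpha_le_kite (n ω : ℕ) (hn : 2 ≤ n) (hω2 : 2 ≤ ω) (G : SimpleGraph V)
    (hcard : Fintype.card V = n) (hconn : G.Connected)
    (hclique : ∃ s : Finset V, G.IsNClique ω s)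
    (hmax : ∀ k : ℕ, (∃ s : Finset V, G.IsNClique k s) → k ≤ ω)
    (α : ℝ) (hα0 : 0 ≤ α) (hα1 : α < 1) :
    muAlpha G α ≤ muAlpha (kite n ω) α ∧
      (muAlpha G α = muAlpha (kite n ω) α ↔ Nonempty (G ≃g kite n ω)) := by
  obtain ⟨k, rfl⟩ := Nat.exists_eq_add_of_le' hω2
  obtain ⟨K, hK⟩ := hclique
  have : Nonempty V := hconn.nonempty
  have : Nonempty (Fin n) := ⟨⟨0, by omega⟩⟩
  obtain ⟨x, hx, hxμ⟩ := exists_pos_eigenvector hconn hα0 hα1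
  obtain ⟨S, -, hS, hbound⟩ :=
    exists_kiteBound hconn hK (hK.card_eq ▸ card_le_univ K) le_rfl
  obtain rfl := (card_eq_iff_eq_univ S).1 hS
  have hw := formWeight_pos hα0 hα1 hx
  obtain ⟨L, ⟨hinj, hlt⟩, hL⟩ := hbound _ hw
  rw [card_univ, hcard] at hlt
  let σ : V ≃ Fin n := Equiv.ofBijective (fun v => ⟨L v, hlt v (mem_univ v)⟩) <| by
    rw [Fintype.bijective_iff_injective_and_card]
    refine ⟨fun a b hab => hinj (by simp) (by simp) (congrArg Fin.val hab), by simp [hcard]⟩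
  have hσ : ∀ v, ((σ v : Fin n) : ℕ) = L v := fun v => rfl
  have hxx : 0 < x ⬝ᵥ x := by
    obtain ⟨u⟩ := ‹Nonempty V›
    exact sum_pos (fun v _ => mul_pos (hx v) (hx v)) ⟨u, mem_univ u⟩
  have hG : muAlpha G α * (x ⬝ᵥ x) = weightedSum (formWeight α x) G.dist univ := by
    rw [← dotProduct_Dalpha_mulVec, hxμ, dotProduct_smul, smul_eq_mul]
  have hkite : weightedSum (formWeight α x) (fun a b => kiteDist k (L a) (L b)) univ ≤
      muAlpha (kite n (k + 2)) α * (x ⬝ᵥ x) := by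
    have hcomp : (x ∘ σ.symm) ∘ σ = x := by ext; simp
    have h1 := dotProduct_Dalpha_mulVec_le (kite n (k + 2)) α (x ∘ σ.symm)
    have hxx' : x ∘ σ.symm ⬝ᵥ x ∘ σ.symm = x ⬝ᵥ x := by rw [comp_equiv_symm_dotProduct, hcomp]
    rw [hxx', dotProduct_Dalpha_mulVec] at h1
    refine le_trans ?_ h1
    have h2 : weightedSum (formWeight α (x ∘ σ.symm)) (kite n (k + 2)).dist univ =
        weightedSum (formWeight α x) (fun a b => (kite n (k + 2)).dist (σ a) (σ b)) univ := by
      simp only [weightedSum, ← σ.sum_comp, formWeight, Function.comp_apply, σ.symm_apply_apply]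
    rw [h2]
    exact weightedSum_le hw fun a _ b _ => kiteDist_le_dist hn (σ a) (σ b)
  rcases hL with hL | hL
  · have hlt : muAlpha G α < muAlpha (kite n (k + 2)) α :=
      lt_of_mul_lt_mul_right (hG.trans_lt (hL.trans_le hkite)) hxx.le
    exact ⟨hlt.le, fun h => absurd h hlt.ne, fun ⟨e⟩ => muAlpha_congr hconn e α⟩
  · have e : G ≃g kite n (k + 2) := ⟨σ, fun {a b} => by
      rw [← kiteDist_eq_one_iff, hσ, hσ, ← hL a (mem_univ a) b (mem_univ b),
        SimpleGraph.dist_eq_one_iff_adj]⟩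
    have h := muAlpha_congr hconn e α
    exact ⟨h.le, fun _ => ⟨e⟩, fun _ => h⟩

end DistAlpha
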